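/- Let Λ ⊂ ℂ be a finite nonempty set, let a_λ ∈ ℂ \ {0} for λ ∈ Λ, and put E(x) = ∑_{λ∈Λ} a_λ e^{λx} and g(x) = E(x) e^{−πx²}. If α, β > 0 are such that αβ is rational and αβ ≤ 1, then the Gabor system G(g, α, β) is complete in L²(ℝ). -/

import Mathlib

open MeasureTheory Complex Real

/-- The Gabor system `G(g, α, β)` is complete in `L²(ℝ)`: the finite linear span of the
time-frequency shifts `x ↦ e^{2πiβlx} g(x − αk)`, `k, l ∈ ℤ`, is dense in `L²(ℝ, ℂ)`. -/
def GaborComplete (g : ℝ → ℂ) (α β : ℝ) : Prop :=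
  (Submodule.span ℂ {h : Lp ℂ 2 (volume : Measure ℝ) |
      ∃ k l : ℤ, ∀ᵐ x : ℝ, h x =
        Complex.exp (2 * Real.pi * Complex.I * (β * l * x)) * g (x - α * k)}).topologicalClosure
    = ⊤

/-- Zeros of a holomorphic function can be divided out. -/
lemma exists_eq_prod_sub_mul {ι : Type*} {U : Set ℂ} (hU : IsOpen U) (z : ι → ℂ)
    (s : Finset ι) (hz : Set.InjOn z s) (hzU : ∀ i ∈ s, z i ∈ U) {f : ℂ → ℂ}
    (hf : DifferentiableOn ℂ f U) (hf0 : ∀ i ∈ s, f (z i) = 0) :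
    ∃ h : ℂ → ℂ, DifferentiableOn ℂ h U ∧ ∀ w ∈ U, f w = (∏ i ∈ s, (w - z i)) * h w := by
  classical
  induction s using Finset.induction_on with
  | empty => exact ⟨f, hf, by simp⟩
  | insert j s hj ih =>
    obtain ⟨h, hd, hfh⟩ := ih (hz.mono (by simp)) (fun i hi => hzU i (by simp [hi]))
      (fun i hi => hf0 i (by simp [hi]))
    have hjU : z j ∈ U := hzU j (by simp)
    have hhj : h (z j) = 0 := by
      have h1 := hfh _ hjU
      rw [hf0 j (by simp)] at h1
      refine (mul_eq_zero.mp h1.symm).resolve_left (Finset.prod_ne_zero_iff.mpr fun i hi h2 => ?_)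
      have := hz (by simp) (by simp [hi]) (sub_eq_zero.mp h2)
      exact hj (this ▸ hi)
    refine ⟨dslope h (z j), (differentiableOn_dslope (hU.mem_nhds hjU)).mpr hd, fun w hw => ?_⟩
    rw [Finset.prod_insert hj, hfh w hw, mul_comm (w - z j), mul_assoc]
    congr 1
    have := sub_smul_dslope h (z j) w
    rw [hhj, sub_zero, smul_eq_mul] at this
    exact this.symm

lemma Icc_neg_succ_eq_insert (K : ℕ) : Finset.Icc (-((K + 1 : ℕ) : ℤ)) ((K + 1 : ℕ) : ℤ) =
    insert ((K : ℤ) + 1) (insert (-((K : ℤ) + 1)) (Finset.Icc (-(K : ℤ)) K)) := by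
  ext x
  simp only [Finset.mem_Icc, Finset.mem_insert]
  push_cast
  omega

lemma sum_Icc_neg_cast (K : ℕ) : ∑ k ∈ Finset.Icc (-(K : ℤ)) K, (k : ℝ) = 0 := by
  induction K with
  | zero => simp
  | succ K ih =>
    rw [Icc_neg_succ_eq_insert, Finset.sum_insert, Finset.sum_insert, ih]
    · push_cast; ring
    · simp
    · simp; omega

lemma sum_Icc_neg_abs (K : ℕ) :
    ∑ k ∈ Finset.Icc (-(K : ℤ)) K, |(k : ℝ)| = K * (K + 1) := by
  induction K with
  | zero => simp
  | succ K ih =>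
    have h1 : |((K : ℝ) + 1)| = K + 1 := abs_of_nonneg (by positivity)
    have h2 : |(-1 + -(K : ℝ))| = K + 1 := by rw [← h1, ← abs_neg]; congr 1; ring
    rw [Icc_neg_succ_eq_insert, Finset.sum_insert, Finset.sum_insert, ih]
    · push_cast
      rw [abs_neg, h1]; ring
    · simp
    · simp; omega

lemma card_Icc_neg (K : ℕ) : (Finset.Icc (-(K : ℤ)) K).card = 2 * K + 1 := by
  simp only [Int.card_Icc]; omega

/-- A quantitative bound on the unit circle for a function with zeros at a geometric progression. -/
lemma norm_le_of_zeros_exp {Ψ : ℂ → ℂ} (hd : DifferentiableOn ℂ Ψ {0}ᶜ) {C κ μ : ℝ} (hμ : 0 < μ)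
    (hb : ∀ w ≠ 0, ‖Ψ w‖ ≤ C * Real.exp (κ * (Real.log ‖w‖) ^ 2))
    (h0 : ∀ k : ℤ, Ψ (Complex.exp (μ * k)) = 0) {w₀ : ℂ} (hw₀ : ‖w₀‖ = 1) (K : ℕ) :
    ‖Ψ w₀‖ ≤ C * (Real.exp (κ * (μ * (K + 1 / 2)) ^ 2) * Real.exp (-(μ * (K + 1 / 2) * K)) *
      (2 / (1 - Real.exp (-(μ / 2)))) ^ (2 * K + 1) * Real.exp (μ / 2 * (K * (K + 1)))) := by
  set S := Finset.Icc (-(K : ℤ)) K with hS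
  set z : ℤ → ℂ := fun k => Complex.exp (μ * k) with hzdef
  have hzr : ∀ k : ℤ, z k = (Real.exp (μ * k) : ℝ) := fun k => by simp [hzdef]
  have hnz : ∀ k : ℤ, ‖z k‖ = Real.exp (μ * k) := fun k => by
    rw [hzr, Complex.norm_real, Real.norm_of_nonneg (Real.exp_pos _).le]
  have hinj : Function.Injective z := fun i j hij => by
    have := congrArg norm hij
    rw [hnz, hnz] at this
    have := mul_left_cancel₀ hμ.ne' (Real.exp_injective this)
    exact_mod_cast this
  obtain ⟨h, hhd, hΨ⟩ := exists_eq_prod_sub_mul isOpen_compl_singleton z S hinj.injOn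
    (fun i _ => by simp [hzdef, Complex.exp_ne_zero]) hd (fun i _ => h0 i)
  set X : ℝ := μ * (K + 1 / 2) with hX
  have hXpos : 0 < X := by positivity
  set η : ℝ := 1 - Real.exp (-(μ / 2)) with hη
  have hηpos : 0 < η := by
    have : Real.exp (-(μ / 2)) < 1 := Real.exp_lt_one_iff.mpr (by linarith)
    linarith
  set M : ℝ := C * Real.exp (κ * X ^ 2) * Real.exp (-(X * K)) * (1 / η) ^ (2 * K + 1) with hM
  have hMeq : M * η ^ (2 * K + 1) = C * Real.exp (κ * X ^ 2) * Real.exp (-(X * K)) := by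
    rw [hM, mul_assoc, ← mul_pow, one_div_mul_cancel hηpos.ne', one_pow, mul_one]
  -- bound for the quotient on the outer circle
  have hout : ∀ w : ℂ, ‖w‖ = Real.exp X → ‖w ^ K * h w‖ ≤ M := by
    intro w hw
    have hw0 : w ≠ 0 := by
      intro h; rw [h, norm_zero] at hw; exact (Real.exp_pos X).ne hw
    have h1 : (η * Real.exp X) ^ (2 * K + 1) ≤ ‖∏ i ∈ S, (w - z i)‖ := by
      rw [norm_prod, ← card_Icc_neg K, ← Finset.prod_const]
      refine Finset.prod_le_prod (fun _ _ => by positivity) fun k hk => ?_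
      have h2 : Real.exp (μ * k) ≤ Real.exp (-(μ / 2)) * Real.exp X := by
        rw [← Real.exp_add, Real.exp_le_exp, hX]
        have : (k : ℝ) ≤ K := by exact_mod_cast (Finset.mem_Icc.mp hk).2
        nlinarith
      calc η * Real.exp X ≤ ‖w‖ - ‖z k‖ := by rw [hw, hnz, hη]; linarith
        _ ≤ _ := norm_sub_norm_le _ _
    have h3 := hb w hw0
    rw [hΨ w hw0, norm_mul, hw, Real.log_exp] at h3
    have h4 : (η * Real.exp X) ^ (2 * K + 1) * ‖h w‖ ≤ C * Real.exp (κ * X ^ 2) :=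
      (mul_le_mul_of_nonneg_right h1 (norm_nonneg _)).trans h3
    rw [norm_mul, norm_pow, hw]
    have h5 : (Real.exp X) ^ (2 * K + 1) = Real.exp X ^ K * Real.exp X ^ K * Real.exp X := by ring
    have h6 : Real.exp (-(X * K)) * Real.exp X ^ K = 1 := by
      rw [← Real.exp_nat_mul, ← Real.exp_add]; simp; ring
    rw [mul_pow, h5] at h4
    have h7 : 1 ≤ Real.exp X := Real.one_le_exp hXpos.le
    refine le_of_mul_le_mul_right ?_ (pow_pos hηpos (2 * K + 1))
    rw [hMeq]
    have h8 : Real.exp X ^ K * ‖h w‖ * η ^ (2 * K + 1) * (Real.exp X ^ K)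
        ≤ C * Real.exp (κ * X ^ 2) := by
      refine le_trans ?_ h4
      have : 0 ≤ Real.exp X ^ K * ‖h w‖ * η ^ (2 * K + 1) * (Real.exp X ^ K) := by positivity
      nlinarith
    calc _ = Real.exp X ^ K * ‖h w‖ * η ^ (2 * K + 1) *
          (Real.exp (-(X * K)) * Real.exp X ^ K) := by rw [h6, mul_one]
      _ = Real.exp X ^ K * ‖h w‖ * η ^ (2 * K + 1) * (Real.exp X ^ K) * Real.exp (-(X * K)) := by
          ring
      _ ≤ _ := by gcongr
  have hin : ∀ w : ℂ, ‖w‖ = Real.exp (-X) → ‖w ^ K * h w‖ ≤ M := by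
    intro w hw
    have hw0 : w ≠ 0 := by
      intro h; rw [h, norm_zero] at hw; exact (Real.exp_pos (-X)).ne hw
    have h1 : η ^ (2 * K + 1) ≤ ‖∏ i ∈ S, (w - z i)‖ := by
      have e : ∏ k ∈ S, (η * Real.exp (μ * k)) = η ^ (2 * K + 1) := by
        rw [Finset.prod_mul_distrib, Finset.prod_const, card_Icc_neg, ← Real.exp_sum,
          ← Finset.mul_sum, sum_Icc_neg_cast]
        simp
      rw [norm_prod, ← e]
      refine Finset.prod_le_prod (fun _ _ => by positivity) fun k hk => ?_
      have h2 : Real.exp (-X) ≤ Real.exp (-(μ / 2)) * Real.exp (μ * k) := by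
        rw [← Real.exp_add, Real.exp_le_exp, hX]
        have : -(K : ℝ) ≤ k := by exact_mod_cast (Finset.mem_Icc.mp hk).1
        nlinarith
      calc η * Real.exp (μ * k) ≤ ‖z k‖ - ‖w‖ := by rw [hw, hnz, hη]; linarith
        _ ≤ _ := by rw [norm_sub_rev]; exact norm_sub_norm_le _ _
    have h3 := hb w hw0
    rw [hΨ w hw0, norm_mul, hw, Real.log_exp, neg_sq] at h3
    have h4 : η ^ (2 * K + 1) * ‖h w‖ ≤ C * Real.exp (κ * X ^ 2) :=
      (mul_le_mul_of_nonneg_right h1 (norm_nonneg _)).trans h3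
    rw [norm_mul, norm_pow, hw]
    have h6 : Real.exp (-X) ^ K = Real.exp (-(X * K)) := by
      rw [← Real.exp_nat_mul]; congr 1; ring
    refine le_of_mul_le_mul_right ?_ (pow_pos hηpos (2 * K + 1))
    rw [hMeq, h6]
    calc _ = (η ^ (2 * K + 1) * ‖h w‖) * Real.exp (-(X * K)) := by ring
      _ ≤ _ := by gcongr
  -- maximum principle on the annulus
  set U : Set ℂ := {w | Real.exp (-X) < ‖w‖ ∧ ‖w‖ < Real.exp X} with hUdef
  have hcl : closure U ⊆ {w | Real.exp (-X) ≤ ‖w‖ ∧ ‖w‖ ≤ Real.exp X} := by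
    refine closure_minimal (fun w hw => ⟨hw.1.le, hw.2.le⟩) ?_
    exact (isClosed_le continuous_const continuous_norm).inter
      (isClosed_le continuous_norm continuous_const)
  have hUo : IsOpen U := (isOpen_lt continuous_const continuous_norm).inter
      (isOpen_lt continuous_norm continuous_const)
  have hcl0 : closure U ⊆ {0}ᶜ := fun w hw h => by
    have := (hcl hw).1
    rw [Set.mem_singleton_iff.mp h, norm_zero] at this
    exact absurd this (not_le.mpr (Real.exp_pos _))
  have hdq : DifferentiableOn ℂ (fun w => w ^ K * h w) {0}ᶜ :=
    (differentiableOn_id.pow K).mul hhd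
  have hw₀U : w₀ ∈ U := by
    refine ⟨?_, ?_⟩ <;> rw [hw₀]
    · exact Real.exp_lt_one_iff.mpr (by linarith)
    · exact Real.one_lt_exp_iff.mpr hXpos
  have hmax : ‖w₀ ^ K * h w₀‖ ≤ M := by
    refine Complex.norm_le_of_forall_mem_frontier_norm_le (U := U)
      (f := fun w => w ^ K * h w) ?_ ?_ ?_ (subset_closure hw₀U)
    · exact (Metric.isBounded_closedBall (x := (0 : ℂ)) (r := Real.exp X)).subset
        fun w hw => by simpa using hw.2.le
    · exact (hdq.mono hcl0).diffContOnCl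
    · intro w hw
      rw [hUo.frontier_eq] at hw
      have h1 := hcl hw.1
      rcases h1.1.lt_or_eq with h2 | h2
      · rcases h1.2.lt_or_eq with h3 | h3
        · exact absurd ⟨h2, h3⟩ hw.2
        · exact hout w h3
      · exact hin w h2.symm
  have hprod : ‖∏ i ∈ S, (w₀ - z i)‖ ≤ 2 ^ (2 * K + 1) * Real.exp (μ / 2 * (K * (K + 1))) := by
    have e : ∏ k ∈ S, (2 * Real.exp (μ / 2 * |(k : ℝ)| + μ / 2 * k)) =
        2 ^ (2 * K + 1) * Real.exp (μ / 2 * (K * (K + 1))) := by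
      rw [Finset.prod_mul_distrib, Finset.prod_const, card_Icc_neg, ← Real.exp_sum,
        Finset.sum_add_distrib, ← Finset.mul_sum, ← Finset.mul_sum, sum_Icc_neg_cast,
        sum_Icc_neg_abs, mul_zero, add_zero]
    rw [norm_prod, ← e]
    refine Finset.prod_le_prod (fun _ _ => norm_nonneg _) fun k _ => ?_
    refine (norm_sub_le _ _).trans ?_
    rw [hw₀, hnz]
    have h1 : (1 : ℝ) ≤ Real.exp (μ / 2 * |(k : ℝ)| + μ / 2 * k) := by
      apply Real.one_le_exp
      nlinarith [neg_abs_le (k : ℝ)]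
    have h2 : Real.exp (μ * k) ≤ Real.exp (μ / 2 * |(k : ℝ)| + μ / 2 * k) := by
      rw [Real.exp_le_exp]
      nlinarith [le_abs_self (k : ℝ)]
    linarith
  rw [norm_mul, norm_pow, hw₀, one_pow, one_mul] at hmax
  have hw₀0 : w₀ ≠ 0 := fun h => by simp [h] at hw₀
  rw [hΨ w₀ hw₀0, norm_mul]
  calc _ ≤ (2 ^ (2 * K + 1) * Real.exp (μ / 2 * (K * (K + 1)))) * M := by gcongr
    _ = _ := by rw [hM, div_pow, div_pow, one_pow]; ring

/-- A holomorphic function on the punctured plane of small Gaussian growth in `log ‖w‖` that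
vanishes on a geometric progression vanishes on the unit circle. -/
lemma eq_zero_of_zeros_exp {Ψ : ℂ → ℂ} (hd : DifferentiableOn ℂ Ψ {0}ᶜ) {C κ μ : ℝ} (hμ : 0 < μ)
    (hκμ : 2 * κ * μ < 1)
    (hb : ∀ w ≠ 0, ‖Ψ w‖ ≤ C * Real.exp (κ * (Real.log ‖w‖) ^ 2))
    (h0 : ∀ k : ℤ, Ψ (Complex.exp (μ * k)) = 0) {w₀ : ℂ} (hw₀ : ‖w₀‖ = 1) : Ψ w₀ = 0 := by
  have hη : 0 < 1 - Real.exp (-(μ / 2)) := by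
    have : Real.exp (-(μ / 2)) < 1 := Real.exp_lt_one_iff.mpr (by linarith)
    linarith
  set B := Real.log (2 / (1 - Real.exp (-(μ / 2)))) with hB
  have hBexp : Real.exp B = 2 / (1 - Real.exp (-(μ / 2))) := Real.exp_log (by positivity)
  set c := μ * (1 / 2 - κ * μ) with hc
  have hcpos : 0 < c := mul_pos hμ (by linarith)
  have key : ∀ K : ℕ, ‖Ψ w₀‖ ≤
      C * Real.exp ((K : ℝ) * (-c * K + (κ * μ ^ 2 + 2 * B)) + (κ * μ ^ 2 / 4 + B)) := by
    intro K
    refine (norm_le_of_zeros_exp hd hμ hb h0 hw₀ K).trans_eq ?_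
    rw [← hBexp, ← Real.exp_nat_mul, ← Real.exp_add, ← Real.exp_add, ← Real.exp_add]
    congr 2
    push_cast
    rw [hc]
    ring
  have hlim : Filter.Tendsto (fun K : ℕ =>
      C * Real.exp ((K : ℝ) * (-c * K + (κ * μ ^ 2 + 2 * B)) + (κ * μ ^ 2 / 4 + B)))
      Filter.atTop (nhds (C * 0)) := by
    refine Filter.Tendsto.const_mul _ (Real.tendsto_exp_atBot.comp ?_)
    refine Filter.tendsto_atBot_add_const_right _ _ ?_
    refine Filter.Tendsto.atTop_mul_atBot₀ tendsto_natCast_atTop_atTop ?_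
    refine Filter.tendsto_atBot_add_const_right _ _ ?_
    exact Filter.Tendsto.const_mul_atTop_of_neg (by linarith) tendsto_natCast_atTop_atTop
  have := ge_of_tendsto' hlim key
  rw [mul_zero] at this
  exact norm_le_zero_iff.mp this

lemma jacobiTheta₂_imaginary_ne_zero (y : ℝ) {t : ℝ} (ht : 0 < t) :
    jacobiTheta₂ (I * y) (I * t) ≠ 0 := by
  have him : 0 < (I * (t : ℂ)).im := by simpa using ht
  have h1 := hasSum_jacobiTheta₂_term (I * y) him
  have e : ∀ n : ℤ, jacobiTheta₂_term n (I * y) (I * t) =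
      ((Real.exp (-(2 * π * n * y) - π * n ^ 2 * t) : ℝ) : ℂ) := by
    intro n
    rw [jacobiTheta₂_term, Complex.ofReal_exp]
    congr 1
    push_cast
    linear_combination (2 * π * n * y + π * n ^ 2 * t : ℂ) * I_mul_I
  simp_rw [e] at h1
  have hs : Summable fun n : ℤ => Real.exp (-(2 * π * n * y) - π * n ^ 2 * t) :=
    Complex.summable_ofReal.mp h1.summable
  have h2 : 0 < ∑' n : ℤ, Real.exp (-(2 * π * n * y) - π * n ^ 2 * t) :=
    hs.tsum_pos (fun n => (Real.exp_pos _).le) 0 (Real.exp_pos _)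
  rw [← h1.tsum_eq, ← Complex.ofReal_tsum]
  exact_mod_cast h2.ne'

/-- A continuous function with periods `1` and `i Y` is bounded. -/
lemma exists_le_of_doubly_periodic {N : ℂ → ℝ} (hN : Continuous N) {Y : ℝ} (hY : 0 < Y)
    (h1 : Function.Periodic N 1) (h2 : Function.Periodic N (Y * I)) : ∃ C, ∀ z, N z ≤ C := by
  obtain ⟨C, hC⟩ := ((isCompact_Icc (a := (0 : ℝ)) (b := 1)).reProdIm
    (isCompact_Icc (a := (0 : ℝ)) (b := Y))).bddAbove_image hN.continuousOn
  refine ⟨C, fun z => ?_⟩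
  have h3 : N (z - ⌊z.re⌋ * 1 - ⌊z.im / Y⌋ * (Y * I)) = N z := by
    rw [h2.sub_int_mul_eq, h1.sub_int_mul_eq]
  rw [← h3]
  refine hC (Set.mem_image_of_mem _ ?_)
  rw [Complex.mem_reProdIm]
  have h4 := Int.floor_le (z.im / Y)
  have h5 := (Int.lt_floor_add_one (z.im / Y)).le
  rw [le_div_iff₀ hY] at h4
  rw [div_le_iff₀ hY] at h5
  constructor
  · simpa using (Int.fract_lt_one _).le
  · simp
    constructor <;> linarith

/-- The finite theta combination obtained from the Zak transform of a Gaussian. -/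
noncomputable def thetaSum {p : ℕ} (b : ℝ) (v : Fin p → ℂ) (z : ℂ) : ℂ :=
  ∑ r : Fin p, v r * Complex.exp (-π * (r * b) ^ 2 + 2 * π * I * r * z) *
    jacobiTheta₂ (I * (p * b * (r * b) : ℝ) + p * z) (I * ((p * b) ^ 2 : ℝ))

lemma im_I_mul_sq_pos {p : ℕ} (hp : 0 < p) {b : ℝ} (hb : 0 < b) :
    0 < (I * (((p * b) ^ 2 : ℝ) : ℂ)).im := by
  rw [Complex.I_mul_im, Complex.ofReal_re]
  positivity

lemma differentiable_jacobiTheta₂ {T : ℂ} (hT : 0 < T.im) :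
    Differentiable ℂ fun z => jacobiTheta₂ z T :=
  fun _ => differentiableAt_jacobiTheta₂_fst _ hT

lemma differentiable_thetaSum {p : ℕ} (hp : 0 < p) {b : ℝ} (hb : 0 < b) (v : Fin p → ℂ) :
    Differentiable ℂ (thetaSum b v) := by
  have hθ := differentiable_jacobiTheta₂ (im_I_mul_sq_pos hp hb)
  unfold thetaSum
  refine Differentiable.fun_sum fun r _ => Differentiable.mul (by fun_prop) ?_
  exact hθ.comp (f := fun z : ℂ => I * ((p * b * (r * b) : ℝ) : ℂ) + p * z) (by fun_prop)

lemma jacobiTheta₂_add_natCast (z τ : ℂ) (n : ℕ) :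
    jacobiTheta₂ (z + n) τ = jacobiTheta₂ z τ := by
  have h : Function.Periodic (fun z => jacobiTheta₂ z τ) 1 := fun z => jacobiTheta₂_add_left z τ
  simpa using h.nat_mul n z

lemma thetaSum_add_one {p : ℕ} (b : ℝ) (v : Fin p → ℂ) (z : ℂ) :
    thetaSum b v (z + 1) = thetaSum b v z := by
  unfold thetaSum
  refine Finset.sum_congr rfl fun r _ => ?_
  rw [mul_add (p : ℂ), mul_one, ← add_assoc, jacobiTheta₂_add_natCast]
  congr 2
  rw [show (-π * (r * b) ^ 2 + 2 * π * I * r * (z + 1) : ℂ) =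
    (-π * (r * b) ^ 2 + 2 * π * I * r * z) + (r : ℕ) * (2 * π * I) by ring, Complex.exp_add,
    Complex.exp_nat_mul_two_pi_mul_I, mul_one]

lemma thetaSum_sub {p : ℕ} (b : ℝ) (v : Fin p → ℂ) (z : ℂ) :
    thetaSum b v (z - (p * b ^ 2 : ℝ) * I) =
      Complex.exp (2 * π * I * p * z + π * (p * b) ^ 2) * thetaSum b v z := by
  unfold thetaSum
  rw [Finset.mul_sum]
  refine Finset.sum_congr rfl fun r _ => ?_
  have h := jacobiTheta₂_add_left' (I * (p * b * (r * b) : ℝ) + p * (z - (p * b ^ 2 : ℝ) * I))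
    (I * ((p * b) ^ 2 : ℝ))
  rw [show I * (p * b * (r * b) : ℝ) + p * (z - (p * b ^ 2 : ℝ) * I) + (I * ((p * b) ^ 2 : ℝ))
    = I * (p * b * (r * b) : ℝ) + p * z by push_cast; ring] at h
  rw [h]
  set θ := jacobiTheta₂ (I * (p * b * (r * b) : ℝ) + p * (z - (p * b ^ 2 : ℝ) * I))
    (I * ((p * b) ^ 2 : ℝ))
  rw [show ∀ A B C : ℂ, A * (v r * B * (C * θ)) = v r * (A * B * C) * θ by intros; ring,
    ← Complex.exp_add, ← Complex.exp_add]
  congr 3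
  push_cast
  ring_nf
  simp only [I_sq]
  ring

lemma thetaSum_eq_zero {p q : ℕ} (hp : 0 < p) (hpq : p < q) {b : ℝ} (hb : 0 < b)
    (v : Fin p → ℂ)
    (h : ∀ s : Fin q, thetaSum b v (-(2 * π * b * (p * b / q) * s : ℝ) / (2 * π) * I) = 0) :
    v = 0 := by
  have hq : 0 < q := hp.trans hpq
  have hqR : (0 : ℝ) < q := by exact_mod_cast hq
  have hpR : (0 : ℝ) < p := by exact_mod_cast hp
  have hπ := Real.pi_pos
  set f := thetaSum b v with hf
  have hfd : Differentiable ℂ f := differentiable_thetaSum hp hb v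
  set N : ℂ → ℝ := fun z => ‖f z‖ * Real.exp (-(π * z.im ^ 2 / b ^ 2)) with hN
  have hNc : Continuous N := by
    have := hfd.continuous
    have := Complex.continuous_im
    fun_prop
  set Y : ℝ := p * b ^ 2 with hY
  have hYpos : 0 < Y := by positivity
  have hN1 : Function.Periodic N 1 := fun z => by simp [hN, hf, thetaSum_add_one]
  have hN2 : Function.Periodic N (Y * I) := by
    have h3 : ∀ z, N (z - Y * I) = N z := fun z => by
      have him : (z - (Y : ℂ) * I).im = z.im - Y := by simp
      simp only [hN, hf]
      rw [him, hY, thetaSum_sub, norm_mul, Complex.norm_exp, mul_right_comm, ← Real.exp_add, mul_comm]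
      congr 2
      have e1 : (2 * π * I * p * z + π * (p * b) ^ 2 : ℂ) =
        ((π * (p * b) ^ 2 : ℝ) : ℂ) + ((2 * π * p : ℝ) : ℂ) * (I * z) := by push_cast; ring
      rw [e1, Complex.add_re, Complex.ofReal_re, Complex.re_ofReal_mul]
      rw [Complex.I_mul_re]
      field_simp
      ring
    intro z
    have := h3 (z + Y * I)
    rw [add_sub_cancel_right] at this
    exact this.symm
  obtain ⟨C, hC⟩ := exists_le_of_doubly_periodic hNc hYpos hN1 hN2
  have hfN : ∀ z, N z = 0 → f z = 0 := fun z hz => by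
    have := (mul_eq_zero.mp hz).resolve_right (Real.exp_pos _).ne'
    exact norm_eq_zero.mp this
  set μ : ℝ := 2 * π * b * (p * b / q) with hμ
  have hμpos : 0 < μ := by positivity
  have hzero : ∀ k : ℤ, f (-(μ * k : ℝ) / (2 * π) * I) = 0 := by
    intro k
    apply hfN
    have hk := Int.emod_add_mul_ediv k q
    have hk0 := Int.emod_nonneg k (by exact_mod_cast hq.ne' : (q : ℤ) ≠ 0)
    have hk1 := Int.emod_lt_of_pos k (by exact_mod_cast hq : (0 : ℤ) < q)
    obtain ⟨s, hs⟩ := Int.eq_ofNat_of_zero_le hk0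
    have hsq : s < q := by rw [hs] at hk1; exact_mod_cast hk1
    have h4 := h ⟨s, hsq⟩
    have h5 : N (-(μ * s : ℝ) / (2 * π) * I) = 0 := by simp only [hN]; rw [h4]; simp
    have h6 := hN2.sub_int_mul_eq (k / q) (x := -(μ * s : ℝ) / (2 * π) * I)
    rw [← h5, ← h6]
    congr 1
    have hkC : (k : ℂ) = s + q * (k / q : ℤ) := by
      rw [hs] at hk; exact_mod_cast hk.symm
    have hπC : (π : ℂ) ≠ 0 := by exact_mod_cast hπ.ne'
    have hqC : (q : ℂ) ≠ 0 := by exact_mod_cast hq.ne'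
    push_cast
    rw [hkC, hμ, hY]
    push_cast
    field_simp
    ring
  set Ψ := Function.Periodic.cuspFunction 1 f with hΨ
  have hper : Function.Periodic f ((1 : ℝ) : ℂ) := fun z => by
    rw [Complex.ofReal_one]; exact thetaSum_add_one b v z
  have hΨf : ∀ z, Ψ (Function.Periodic.qParam 1 z) = f z :=
    Function.Periodic.eq_cuspFunction one_ne_zero hper
  have hΨd : DifferentiableOn ℂ Ψ {0}ᶜ := fun w hw => by
    rw [← Function.Periodic.qParam_right_inv one_ne_zero hw]
    exact (Function.Periodic.differentiableAt_cuspFunction one_ne_zero hper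
      (hfd _)).differentiableWithinAt
  have hΨb : ∀ w ≠ 0, ‖Ψ w‖ ≤ C * Real.exp (1 / (4 * π * b ^ 2) * (Real.log ‖w‖) ^ 2) := by
    intro w hw
    rw [hΨ, Function.Periodic.cuspFunction_eq_of_nonzero _ _ hw]
    have h6 := hC (Function.Periodic.invQParam 1 w)
    simp only [hN, Function.Periodic.im_invQParam] at h6
    rw [Real.exp_neg, ← div_eq_mul_inv, div_le_iff₀ (Real.exp_pos _)] at h6
    refine h6.trans_eq ?_
    congr 2
    field_simp
    ring
  have hΨ0 : ∀ k : ℤ, Ψ (Complex.exp (μ * k)) = 0 := fun k => by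
    rw [← hzero k, ← hΨf, Function.Periodic.qParam]
    congr 2
    have : (π : ℂ) ≠ 0 := by exact_mod_cast hπ.ne'
    push_cast
    field_simp
    simp
  have hκμ : 2 * (1 / (4 * π * b ^ 2)) * μ < 1 := by
    have : 2 * (1 / (4 * π * b ^ 2)) * μ = p / q := by rw [hμ]; field_simp; norm_num
    rw [this, div_lt_one hqR]
    exact_mod_cast hpq
  have hpC : (p : ℂ) ≠ 0 := by exact_mod_cast hp.ne'
  have hroot : ∀ l : ℕ, f ((l : ℂ) / p) = 0 := fun l => by
    rw [← hΨf]
    refine eq_zero_of_zeros_exp hΨd hμpos hκμ hΨb hΨ0 ?_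
    rw [Function.Periodic.norm_qParam]
    simp [← Complex.ofReal_natCast, ← Complex.ofReal_div]
  have hprim : IsPrimitiveRoot (Complex.exp (2 * π * I / p)) p :=
    Complex.isPrimitiveRoot_exp p hp.ne'
  have hv' := Matrix.eq_zero_of_forall_index_sum_mul_pow_eq_zero
    (f := fun l : Fin p => Complex.exp (2 * π * I / p) ^ (l : ℕ))
    (v := fun r => v r * Complex.exp (-π * (r * b) ^ 2) *
      jacobiTheta₂ (I * (p * b * (r * b) : ℝ)) (I * ((p * b) ^ 2 : ℝ)))
    (fun i j hij => Fin.ext (hprim.pow_inj i.2 j.2 hij)) (fun l => by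
      rw [← hroot l, hf, thetaSum]
      refine Finset.sum_congr rfl fun r _ => ?_
      rw [mul_div_cancel₀ _ hpC, jacobiTheta₂_add_natCast, Complex.exp_add, ← pow_mul,
        ← Complex.exp_nat_mul, show (((l : ℕ) * (r : ℕ) : ℕ) : ℂ) * (2 * π * I / p) =
          2 * π * I * r * (l / p) by push_cast; ring]
      ring)
  funext r
  have := congrFun hv' r
  simp only [Pi.zero_apply, mul_eq_zero, Complex.exp_ne_zero, or_false] at this
  exact this.resolve_right (jacobiTheta₂_imaginary_ne_zero _ (by positivity))

/-- The Zak transform of the product of an exponential polynomial and a Gaussian, continued to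
complex arguments. -/
noncomputable def zakTheta (Λ : Finset ℂ) (a : ℂ → ℂ) (L : ℝ) (z ω : ℂ) : ℂ :=
  ∑ lam ∈ Λ, a lam * Complex.exp (lam * z - π * z ^ 2) *
    jacobiTheta₂ (ω + I * L * z - I * lam * L / (2 * π)) (I * (L ^ 2 : ℝ))

lemma hasSum_zakTheta (Λ : Finset ℂ) (a : ℂ → ℂ) {L : ℝ} (hL : 0 < L) (z ω : ℂ) :
    HasSum (fun n : ℤ => (∑ lam ∈ Λ, a lam * Complex.exp (lam * (z + L * n))) *
      Complex.exp (-π * (z + L * n) ^ 2) * Complex.exp (2 * π * I * n * ω))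
      (zakTheta Λ a L z ω) := by
  have hT : 0 < (I * ((L ^ 2 : ℝ) : ℂ)).im := by
    rw [Complex.I_mul_im, Complex.ofReal_re]; positivity
  simp_rw [Finset.sum_mul]
  refine hasSum_sum fun lam _ => ?_
  have h := (hasSum_jacobiTheta₂_term (ω + I * L * z - I * lam * L / (2 * π)) hT).mul_left
    (a lam * Complex.exp (lam * z - π * z ^ 2))
  refine h.congr_fun fun n => ?_
  have hπ : (π : ℂ) ≠ 0 := by exact_mod_cast Real.pi_ne_zero
  rw [jacobiTheta₂_term,
    show ∀ A B C : ℂ, a lam * A * B * C = a lam * (A * B * C) by intros; ring,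
    show ∀ A B : ℂ, a lam * A * B = a lam * (A * B) by intros; ring,
    ← Complex.exp_add, ← Complex.exp_add, ← Complex.exp_add]
  congr 2
  push_cast
  field_simp
  ring_nf
  simp only [I_sq]
  ring

lemma differentiable_zakTheta_left (Λ : Finset ℂ) (a : ℂ → ℂ) {L : ℝ} (hL : 0 < L) (u ω : ℂ) :
    Differentiable ℂ fun x => zakTheta Λ a L (x + u) ω := by
  have hT : 0 < (I * ((L ^ 2 : ℝ) : ℂ)).im := by
    rw [Complex.I_mul_im, Complex.ofReal_re]; positivity
  unfold zakTheta
  refine Differentiable.fun_sum fun lam _ => Differentiable.mul (by fun_prop) ?_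
  exact (differentiable_jacobiTheta₂ hT).comp
    (f := fun x : ℂ => ω + I * L * (x + u) - I * lam * L / (2 * π)) (by fun_prop)

lemma differentiable_zakTheta_right (Λ : Finset ℂ) (a : ℂ → ℂ) {L : ℝ} (hL : 0 < L) (z : ℂ) :
    Differentiable ℂ fun ω => zakTheta Λ a L z ω := by
  have hT : 0 < (I * ((L ^ 2 : ℝ) : ℂ)).im := by
    rw [Complex.I_mul_im, Complex.ofReal_re]; positivity
  unfold zakTheta
  refine Differentiable.fun_sum fun lam _ => Differentiable.mul (by fun_prop) ?_
  exact (differentiable_jacobiTheta₂ hT).comp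
    (f := fun x : ℂ => x + I * L * z - I * lam * L / (2 * π)) (by fun_prop)

lemma differentiable_det {n : ℕ} {M : ℂ → Matrix (Fin n) (Fin n) ℂ}
    (hM : ∀ i j, Differentiable ℂ fun z => M z i j) : Differentiable ℂ fun z => (M z).det := by
  simp_rw [Matrix.det_apply]
  refine Differentiable.fun_sum fun σ _ => Differentiable.const_smul ?_ _
  exact Differentiable.fun_finsetProd fun i _ => hM _ _

lemma countable_real_zeros {f : ℂ → ℂ} (hf : Differentiable ℂ f) {z₀ : ℂ} (hz₀ : f z₀ ≠ 0) :
    {x : ℝ | f x = 0}.Countable := by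
  have h1 : AnalyticOnNhd ℂ f Set.univ := fun z _ => hf.analyticAt z
  have h2 := h1.preimage_zero_mem_codiscrete hz₀
  have h3 := isDiscrete_of_codiscreteWithin (U := Set.univ) (s := {z | f z = 0}) h2
  rw [Set.inter_univ] at h3
  have h4 : {z | f z = 0}.Countable :=
    (HereditarilyLindelofSpace.isLindelof _).countable_of_isDiscrete h3
  exact h4.preimage Complex.ofReal_injective

/-- Real translates of the lattice points entering the Zibulski-Zeevi matrix. -/
noncomputable def zzShift {p q : ℕ} (b : ℝ) (s : Fin q) (r : Fin p) : ℝ :=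
  r * b - s * (p * b / q)

/-- The Zibulski-Zeevi matrix. -/
noncomputable def zzMatrix (p q : ℕ) (b : ℝ) (Λ : Finset ℂ) (a : ℂ → ℂ) (x ω : ℂ) :
    Matrix (Fin q) (Fin p) ℂ :=
  Matrix.of fun s r => zakTheta Λ a (p * b) (x + zzShift b s r) ω

/-- The Zibulski-Zeevi matrix of the Gaussian at the origin. -/
noncomputable def gaussMatrix (p q : ℕ) (b : ℝ) : Matrix (Fin q) (Fin p) ℂ :=
  Matrix.of fun s r => Complex.exp (-π * (zzShift b s r : ℝ) ^ 2) *
    jacobiTheta₂ (I * (p * b * zzShift b s r : ℝ)) (I * ((p * b) ^ 2 : ℝ))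

lemma gaussMatrix_injective {p q : ℕ} (hp : 0 < p) (hpq : p < q ∨ p = 1 ∧ q = 1) {b : ℝ}
    (hb : 0 < b) {v : Fin p → ℂ} (hv : (gaussMatrix p q b).mulVec v = 0) : v = 0 := by
  rcases hpq with hpq | ⟨rfl, rfl⟩
  · refine thetaSum_eq_zero hp hpq hb v fun s => ?_
    have h := congrFun hv s
    have hπ : (π : ℂ) ≠ 0 := by exact_mod_cast Real.pi_ne_zero
    have hq : (q : ℂ) ≠ 0 := by exact_mod_cast (hp.trans hpq).ne'
    have h2 : thetaSum b v (-(2 * π * b * (p * b / q) * s : ℝ) / (2 * π) * I) =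
        Complex.exp (π * (s * (p * b / q)) ^ 2) * ((gaussMatrix p q b).mulVec v s) := by
      rw [Matrix.mulVec, dotProduct, thetaSum, Finset.mul_sum]
      refine Finset.sum_congr rfl fun r _ => ?_
      rw [gaussMatrix, Matrix.of_apply, zzShift,
        show ∀ A B C D : ℂ, A * (B * C * D) = D * (A * B) * C by intros; ring, ← Complex.exp_add]
      congr 3
      · push_cast
        field_simp
        ring_nf
        simp only [I_sq]
        ring
      · push_cast
        field_simp
        ring
    rw [h2, h]
    simp
  · funext r
    have h := congrFun hv 0
    rw [Matrix.mulVec, dotProduct, Fin.sum_univ_one, gaussMatrix, Matrix.of_apply] at h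
    have h1 := (mul_eq_zero.mp h).resolve_left
      (mul_ne_zero (Complex.exp_ne_zero _) (jacobiTheta₂_imaginary_ne_zero _ (by positivity)))
    rw [Subsingleton.elim r 0, h1]; rfl

lemma exists_left_inverse_of_mulVec {p q : ℕ} (G : Matrix (Fin q) (Fin p) ℂ)
    (h : ∀ v, G.mulVec v = 0 → v = 0) : ∃ B : Matrix (Fin p) (Fin q) ℂ, B * G = 1 := by
  obtain ⟨g, hg⟩ := LinearMap.exists_leftInverse_of_injective (Matrix.toLin' G)
    (LinearMap.ker_eq_bot'.mpr fun v hv => h v (by simpa using hv))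
  refine ⟨LinearMap.toMatrix' g, ?_⟩
  have := congrArg LinearMap.toMatrix' hg
  rwa [LinearMap.toMatrix'_comp, LinearMap.toMatrix'_toLin', LinearMap.toMatrix'_id] at this

lemma re_mul_conj_lt {z w : ℂ} (h : ‖z‖ ≤ ‖w‖) (hne : z ≠ w) :
    ((z - w) * (starRingEnd ℂ) w).re < 0 := by
  have h1 : 0 < Complex.normSq (z - w) := Complex.normSq_pos.mpr (sub_ne_zero.mpr hne)
  have h2 : Complex.normSq z ≤ Complex.normSq w := by
    rw [Complex.normSq_eq_norm_sq, Complex.normSq_eq_norm_sq]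
    gcongr
  rw [Complex.normSq_apply] at *
  simp at h1 h2 ⊢
  rw [Complex.normSq_apply] at h2
  nlinarith

lemma exists_det_mul_zzMatrix_ne_zero {p q : ℕ} (hp : 0 < p) (hpq : p < q ∨ p = 1 ∧ q = 1)
    {b : ℝ} (hb : 0 < b) {Λ : Finset ℂ} (hΛ : Λ.Nonempty) {a : ℂ → ℂ}
    (ha : ∀ lam ∈ Λ, a lam ≠ 0) :
    ∃ (A : Matrix (Fin p) (Fin q) ℂ) (x ω : ℂ), (A * zzMatrix p q b Λ a x ω).det ≠ 0 := by
  obtain ⟨l, hl, hmax⟩ := Λ.exists_max_image (fun z => ‖z‖) hΛ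
  obtain ⟨B, hB⟩ := exists_left_inverse_of_mulVec (a l • gaussMatrix p q b) fun v hv => by
    rw [Matrix.smul_mulVec, smul_eq_zero] at hv
    exact gaussMatrix_injective hp hpq hb (hv.resolve_left (ha l hl))
  set L : ℝ := p * b with hL
  set X : ℝ → ℂ := fun t => t * (starRingEnd ℂ) l with hX
  set W : ℝ → ℂ := fun t => I * l * L / (2 * π) - I * L * X t with hW
  set R : ℝ → Fin q → ℂ := fun t s => Complex.exp
    ((s * (p * b / q) : ℝ) * (l - 2 * π * X t) - l * X t + π * X t ^ 2) with hR
  set Cc : ℝ → Fin p → ℂ := fun t r => Complex.exp ((r * b : ℝ) * (2 * π * X t - l)) with hC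
  set N : ℝ → Matrix (Fin q) (Fin p) ℂ := fun t =>
    Matrix.diagonal (R t) * zzMatrix p q b Λ a (X t) (W t) * Matrix.diagonal (Cc t) with hN
  have hNe : ∀ t s r, N t s r = ∑ lam ∈ Λ, a lam *
      Complex.exp ((lam - l) * (starRingEnd ℂ) l * t) *
      (Complex.exp ((lam - l) * zzShift b s r - π * (zzShift b s r) ^ 2) *
      jacobiTheta₂ (I * (L * zzShift b s r : ℝ) + I * (l - lam) * L / (2 * π))
        (I * (L ^ 2 : ℝ))) := by
    intro t s r
    rw [hN]
    simp only [Matrix.mul_diagonal, Matrix.diagonal_mul]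
    rw [zzMatrix, Matrix.of_apply, zakTheta, ← hL, Finset.mul_sum, Finset.sum_mul]
    refine Finset.sum_congr rfl fun lam _ => ?_
    rw [show W t + I * L * (X t + zzShift b s r) - I * lam * L / (2 * π) =
      I * (L * zzShift b s r : ℝ) + I * (l - lam) * L / (2 * π) by
        rw [hW]; push_cast; ring]
    generalize jacobiTheta₂ _ _ = θ
    rw [show ∀ A B C : ℂ, A * (a lam * B * θ) * C = a lam * (A * B * C) * θ by intros; ring,
      show ∀ A B : ℂ, a lam * A * (B * θ) = a lam * (A * B) * θ by intros; ring]
    rw [hR, hC]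
    simp only [← Complex.exp_add]
    congr 3
    rw [hX]
    simp only [zzShift]
    push_cast
    ring
  have hlim : Filter.Tendsto N Filter.atTop (nhds (a l • gaussMatrix p q b)) := by
    refine tendsto_pi_nhds.mpr fun s => tendsto_pi_nhds.mpr fun r => ?_
    change Filter.Tendsto (fun t => N t s r) _ (nhds (a l * gaussMatrix p q b s r))
    simp_rw [hNe]
    have h1 : a l * gaussMatrix p q b s r =
        ∑ lam ∈ Λ, if lam = l then a l * gaussMatrix p q b s r else 0 := by
      rw [Finset.sum_ite_eq', if_pos hl]
    rw [h1]
    refine tendsto_finsetSum _ fun lam hlam => ?_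
    split_ifs with hlam'
    · subst hlam'
      refine tendsto_const_nhds.congr fun t => ?_
      simp [gaussMatrix, hL]
    · have h2 := re_mul_conj_lt (hmax lam hlam) hlam'
      have h3 : Filter.Tendsto (fun t : ℝ => Complex.exp ((lam - l) * (starRingEnd ℂ) l * t))
          Filter.atTop (nhds 0) := by
        rw [tendsto_zero_iff_norm_tendsto_zero]
        simp_rw [Complex.norm_exp, Complex.re_mul_ofReal]
        exact Real.tendsto_exp_atBot.comp (Filter.tendsto_id.const_mul_atTop_of_neg h2)
      simpa using (h3.const_mul (a lam)).mul_const _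
  have hdet : Filter.Tendsto (fun t => (B * N t).det) Filter.atTop (nhds 1) := by
    have h1 : Continuous fun G : Matrix (Fin q) (Fin p) ℂ => (B * G).det := by fun_prop
    have h2 := (h1.tendsto (a l • gaussMatrix p q b)).comp hlim
    rw [hB, Matrix.det_one] at h2
    exact h2
  obtain ⟨t, ht⟩ := (hdet.eventually_ne one_ne_zero).exists
  refine ⟨B * Matrix.diagonal (R t), X t, W t, fun h0 => ht ?_⟩
  rw [hN]
  simp only
  rw [← Matrix.mul_assoc, ← Matrix.mul_assoc, Matrix.det_mul, h0, zero_mul]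

/-- The Zibulski-Zeevi matrix is generically injective. -/
lemma exists_countable_zzMatrix {p q : ℕ} (hp : 0 < p) (hpq : p < q ∨ p = 1 ∧ q = 1)
    {b : ℝ} (hb : 0 < b) {Λ : Finset ℂ} (hΛ : Λ.Nonempty) {a : ℂ → ℂ}
    (ha : ∀ lam ∈ Λ, a lam ≠ 0) :
    ∃ Z : Set ℝ, Z.Countable ∧ ∀ x : ℝ, x ∉ Z → ∃ Y : Set ℝ, Y.Countable ∧
      ∀ ω : ℝ, ω ∉ Y → ∀ v, (zzMatrix p q b Λ a x ω).mulVec v = 0 → v = 0 := by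
  obtain ⟨A, x₀, ω₀, h⟩ := exists_det_mul_zzMatrix_ne_zero hp hpq hb hΛ ha
  have hL : 0 < p * b := by positivity
  have hd1 : ∀ ω, Differentiable ℂ fun x => (A * zzMatrix p q b Λ a x ω).det := fun ω =>
    differentiable_det fun i j => by
      simp_rw [Matrix.mul_apply]
      exact Differentiable.fun_sum fun s _ =>
        (differentiable_zakTheta_left Λ a hL _ ω).const_mul _
  have hd2 : ∀ x, Differentiable ℂ fun ω => (A * zzMatrix p q b Λ a x ω).det := fun x =>
    differentiable_det fun i j => by
      simp_rw [Matrix.mul_apply]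
      exact Differentiable.fun_sum fun s _ =>
        (differentiable_zakTheta_right Λ a hL _).const_mul _
  refine ⟨_, countable_real_zeros (hd1 ω₀) h, fun x hx => ⟨_, countable_real_zeros (hd2 x) hx,
    fun ω hω v hv => ?_⟩⟩
  refine Matrix.eq_zero_of_mulVec_eq_zero hω ?_
  rw [← Matrix.mulVec_mulVec, hv, Matrix.mulVec_zero]

lemma continuous_tsum_fourier {T : ℝ} {G : ℤ → ℂ} (hG : Summable fun n => ‖G n‖) :
    Continuous fun t : AddCircle T => ∑' n, G n * fourier n t := by
  refine continuous_tsum (fun n => by fun_prop) hG fun n t => ?_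
  rw [norm_mul, fourier_apply, Circle.norm_coe, mul_one]

lemma haarAddCircle_countable_eq_zero {s : Set (AddCircle (1 : ℝ))} (hs : s.Countable) :
    (@AddCircle.haarAddCircle (1 : ℝ) _) s = 0 := by
  have h1 : ((1 / 2 : ℝ) : AddCircle (1 : ℝ)) ≠ 0 := by
    rw [Ne, AddCircle.coe_eq_zero_iff]
    rintro ⟨n, hn⟩
    rw [zsmul_eq_mul, mul_one] at hn
    have h2 : ((2 * n : ℤ) : ℝ) = (1 : ℤ) := by push_cast; linarith
    have h3 : 2 * n = 1 := by exact_mod_cast h2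
    omega
  have : Nontrivial (AddCircle (1 : ℝ)) := ⟨⟨_, _, h1⟩⟩
  exact hs.measure_zero _

section FourierUniqueness

variable {T : ℝ} [hT : Fact (0 < T)]

lemma integral_continuousMap_mul_eq_zero {f : AddCircle T → ℂ}
    (hf : Integrable f AddCircle.haarAddCircle) (h : ∀ n, fourierCoeff f n = 0)
    (φ : C(AddCircle T, ℂ)) : ∫ t, φ t * f t ∂AddCircle.haarAddCircle = 0 := by
  have hInt : ∀ ψ : C(AddCircle T, ℂ),
      Integrable (fun t => ψ t * f t) AddCircle.haarAddCircle := fun ψ =>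
    hf.bdd_mul ψ.continuous.aestronglyMeasurable (ae_of_all _ ψ.norm_coe_le_norm)
  let K : C(AddCircle T, ℂ) →ₗ[ℂ] ℂ :=
    { toFun := fun ψ => ∫ t, ψ t * f t ∂AddCircle.haarAddCircle
      map_add' := fun ψ χ => by
        simp only [ContinuousMap.add_apply, add_mul]
        exact integral_add (hInt ψ) (hInt χ)
      map_smul' := fun c ψ => by
        simp only [ContinuousMap.smul_apply, smul_eq_mul, mul_assoc, RingHom.id_apply]
        exact integral_const_mul _ _ }
  let K' := K.mkContinuous (∫ t, ‖f t‖ ∂AddCircle.haarAddCircle) fun ψ => by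
    rw [mul_comm, ← integral_const_mul]
    refine norm_integral_le_of_norm_le (hf.norm.const_mul _) (ae_of_all _ fun t => ?_)
    rw [norm_mul]
    gcongr
    exact ψ.norm_coe_le_norm t
  have hle : (Submodule.span ℂ (Set.range (@fourier T))).topologicalClosure ≤ K'.ker := by
    refine Submodule.topologicalClosure_minimal _ (Submodule.span_le.mpr ?_) K'.isClosed_ker
    rintro _ ⟨n, rfl⟩
    have := h (-n)
    rw [fourierCoeff, neg_neg] at this
    exact this
  rw [span_fourier_closure_eq_top] at hle
  exact hle (Submodule.mem_top (x := φ))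

/-- An integrable function on the circle whose Fourier coefficients vanish is zero. -/
lemma ae_eq_zero_of_fourierCoeff_eq_zero {f : AddCircle T → ℂ}
    (hf : Integrable f AddCircle.haarAddCircle) (h : ∀ n, fourierCoeff f n = 0) :
    f =ᵐ[AddCircle.haarAddCircle] 0 := by
  refine ae_eq_zero_of_forall_setIntegral_isClosed_eq_zero hf fun s hs => ?_
  rw [← integral_indicator hs.measurableSet]
  have hzero : ∀ n, ∫ t, ((hs.apprSeq n t : ℝ) : ℂ) * f t ∂AddCircle.haarAddCircle = 0 :=
    fun n => integral_continuousMap_mul_eq_zero hf h ⟨fun t => ((hs.apprSeq n t : ℝ) : ℂ),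
      Complex.continuous_ofReal.comp (NNReal.continuous_coe.comp (hs.apprSeq n).continuous)⟩
  have hlim : Filter.Tendsto
      (fun n => ∫ t, ((hs.apprSeq n t : ℝ) : ℂ) * f t ∂AddCircle.haarAddCircle) Filter.atTop
      (nhds (∫ t, s.indicator f t ∂AddCircle.haarAddCircle)) := by
    refine tendsto_integral_of_dominated_convergence (fun t => ‖f t‖) (fun n => ?_) hf.norm
      (fun n => ae_of_all _ fun t => ?_) (ae_of_all _ fun t => ?_)
    · exact (Complex.continuous_ofReal.comp (NNReal.continuous_coe.comp
        (hs.apprSeq n).continuous)).aestronglyMeasurable.mul hf.1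
    · rw [norm_mul, Complex.norm_real, Real.norm_of_nonneg (NNReal.coe_nonneg _)]
      exact mul_le_of_le_one_left (norm_nonneg _)
        (NNReal.coe_le_one.mpr (HasOuterApproxClosed.apprSeq_apply_le_one hs n t))
    · have h1 := tendsto_pi_nhds.mp (HasOuterApproxClosed.tendsto_apprSeq hs) t
      have h2 := ((Complex.continuous_ofReal.tendsto _).comp
        ((NNReal.continuous_coe.tendsto _).comp h1)).mul_const (f t)
      suffices h3 : s.indicator f t =
          (((s.indicator (fun _ => 1) t : NNReal) : ℝ) : ℂ) * f t by
        rw [h3]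
        exact h2
      by_cases ht : t ∈ s
      · rw [Set.indicator_of_mem ht, Set.indicator_of_mem ht]
        simp
      · rw [Set.indicator_of_notMem ht, Set.indicator_of_notMem ht]
        simp
  simp_rw [hzero] at hlim
  exact (tendsto_nhds_unique hlim tendsto_const_nhds)

lemma integrable_tsum_fourier_mul {G : ℤ → ℂ} (hG : Summable fun n => ‖G n‖)
    {U : AddCircle T → ℂ} (hU : Integrable U AddCircle.haarAddCircle) :
    Integrable (fun t => (∑' n, G n * fourier n t) * U t) AddCircle.haarAddCircle := by
  refine hU.bdd_mul (c := ∑' n, ‖G n‖) (continuous_tsum_fourier hG).aestronglyMeasurable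
    (ae_of_all _ fun t => tsum_of_norm_bounded hG.hasSum fun n => ?_)
  rw [norm_mul, fourier_apply, Circle.norm_coe, mul_one]

lemma hasSum_fourierCoeff_tsum_mul {G : ℤ → ℂ} (hG : Summable fun n => ‖G n‖)
    {U : AddCircle T → ℂ} (hU : Integrable U AddCircle.haarAddCircle) (m : ℤ) :
    HasSum (fun n => G n * fourierCoeff U (m - n))
      (fourierCoeff (fun t => (∑' n, G n * fourier n t) * U t) m) := by
  have hInt : ∀ n : ℤ, Integrable (fun t => G n * (fourier (-(m - n)) t * U t))
      AddCircle.haarAddCircle := fun n => (hU.fourier_smul _).const_mul _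
  have hnorm : ∀ (n k : ℤ) (t : AddCircle T), ‖G n * (fourier k t * U t)‖ = ‖G n‖ * ‖U t‖ := by
    intro n k t
    rw [norm_mul, norm_mul, fourier_apply, Circle.norm_coe, one_mul]
  have h := hasSum_integral_of_summable_integral_norm hInt (by
    simp_rw [hnorm, integral_const_mul]
    exact hG.mul_right _)
  have h1 : ∀ n, ∫ t, G n * (fourier (-(m - n)) t * U t) ∂AddCircle.haarAddCircle =
      G n * fourierCoeff U (m - n) := fun n => by
    rw [integral_const_mul]; rfl
  simp_rw [h1] at h
  suffices h2 : fourierCoeff (fun t => (∑' n, G n * fourier n t) * U t) m =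
      ∫ t, ∑' n, G n * (fourier (-(m - n)) t * U t) ∂AddCircle.haarAddCircle by
    rwa [h2]
  refine integral_congr_ae (ae_of_all _ fun t => ?_)
  simp only [smul_eq_mul]
  rw [mul_left_comm, ← tsum_mul_right]
  refine tsum_congr fun n => ?_
  rw [show -(m - n) = n + -m by ring, fourier_add]
  ring

end FourierUniqueness

/-- A square-summable sequence orthogonal to all time shifts of the sampled window is zero, provided
that the Zibulski-Zeevi matrix is almost everywhere injective. -/
lemma eq_zero_of_hasSum_shift {p q : ℕ} (hp : 0 < p) (hq : 0 < q) {b : ℝ} (hb : 0 < b)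
    {Λ : Finset ℂ} {a : ℂ → ℂ} {x : ℝ} {Y : Set ℝ} (hY : Y.Countable)
    (hinj : ∀ ω : ℝ, ω ∉ Y → ∀ v, (zzMatrix p q b Λ a x ω).mulVec v = 0 → v = 0)
    {c : ℤ → ℂ} (hc : Summable fun j => ‖c j‖ ^ 2) {g : ℝ → ℂ}
    (hg : ∀ x : ℝ, g x =
      (∑ lam ∈ Λ, a lam * Complex.exp (lam * x)) * Complex.exp (-π * x ^ 2))
    (h : ∀ k : ℤ, HasSum (fun j : ℤ => c j * g (x + j * b - p * b / q * k)) 0) (j : ℤ) :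
    c j = 0 := by
  have hL : 0 < p * b := by positivity
  have hmem : ∀ r : Fin p, Memℓp (fun m : ℤ => c (p * (-m) + r)) 2 := fun r => by
    refine memℓp_gen ?_
    have hi : Function.Injective fun m : ℤ => p * (-m) + (r : ℤ) := fun m n hmn => by
      simpa [hp.ne'] using hmn
    simpa [Function.comp_def] using hc.comp_injective hi
  set U : Fin p → Lp ℂ 2 (@AddCircle.haarAddCircle (1 : ℝ) _) := fun r =>
    fourierBasis.repr.symm ⟨_, hmem r⟩ with hUdef
  have hU : ∀ r m, fourierCoeff (U r) m = c (p * (-m) + r) := fun r m => by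
    rw [← fourierBasis_repr, hUdef, LinearIsometryEquiv.apply_symm_apply]
  have hUint : ∀ r, Integrable (U r) (@AddCircle.haarAddCircle (1 : ℝ) _) := fun r =>
    (Lp.memLp (U r)).integrable one_le_two
  set G : Fin q → Fin p → ℤ → ℂ := fun s r n => g (x + zzShift b s r + (p * b : ℝ) * n) with hGdef
  have hGsum : ∀ s r (ω : ℝ), HasSum (fun n => G s r n * fourier n (ω : AddCircle (1 : ℝ)))
      (zzMatrix p q b Λ a x ω s r) := fun s r ω => by
    have h1 := hasSum_zakTheta Λ a hL (x + zzShift b s r) ω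
    rw [zzMatrix, Matrix.of_apply]
    convert h1 using 2 with n
    rw [hGdef, fourier_coe_apply]
    simp only [hg]
    push_cast
    simp
  have hGs : ∀ s r, Summable fun n => ‖G s r n‖ := fun s r => by
    simpa using (hGsum s r 0).summable.norm
  set V : Fin q → Fin p → AddCircle (1 : ℝ) → ℂ := fun s r t => ∑' n, G s r n * fourier n t
    with hVdef
  have hVU : ∀ s r, Integrable (fun t => V s r t * U r t) (@AddCircle.haarAddCircle (1 : ℝ) _) :=
    fun s r => integrable_tsum_fourier_mul (hGs s r) (hUint r)
  have hcoef : ∀ s m, fourierCoeff (∑ r, fun t => V s r t * U r t) m = 0 := fun s m => by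
    rw [fourierCoeff.sum _ _ fun r _ => hVU s r, Finset.sum_apply]
    have h1 : ∀ r, HasSum (fun n => G s r n * c (p * (n - m) + r))
        (fourierCoeff (fun t => V s r t * U r t) m) := fun r => by
      convert hasSum_fourierCoeff_tsum_mul (hGs s r) (hUint r) m using 3 with n
      rw [hU, neg_sub]
    have h2 := h (s - q * m)
    have : NeZero p := ⟨hp.ne'⟩
    rw [← ((Equiv.prodComm _ _).trans ((Equiv.prodCongr (Equiv.subRight m) (Equiv.refl _)).trans
      (Int.divModEquiv p).symm)).hasSum_iff] at h2
    have h3 := h2.prod_fiberwise (g := fun r => fourierCoeff (fun t => V s r t * U r t) m)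
      fun r => by
        convert h1 r using 2 with n
        simp only [Function.comp, Equiv.trans_apply, Equiv.prodComm_apply, Prod.swap,
          Equiv.prodCongr_apply, Prod.map, Equiv.subRight_apply, Equiv.refl_apply,
          Int.divModEquiv_symm_apply, hGdef, zzShift]
        rw [mul_comm]
        have hq' : (q : ℝ) ≠ 0 := by exact_mod_cast hq.ne'
        congr 2
        · push_cast
          field_simp
          ring
        · ring
    exact (hasSum_fintype _).unique h3
  have hae : ∀ᵐ t ∂(@AddCircle.haarAddCircle (1 : ℝ) _), ∀ s, ∑ r, V s r t * U r t = 0 := by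
    rw [ae_all_iff]
    intro s
    filter_upwards [ae_eq_zero_of_fourierCoeff_eq_zero
      (integrable_finsetSum' _ fun r _ => hVU s r) (hcoef s)] with t ht
    simpa [Finset.sum_apply] using ht
  have hnull : ∀ᵐ t ∂(@AddCircle.haarAddCircle (1 : ℝ) _),
      t ∉ (fun ω : ℝ => (ω : AddCircle (1 : ℝ))) '' Y :=
    measure_eq_zero_iff_ae_notMem.mp (haarAddCircle_countable_eq_zero (hY.image _))
  have hUzero : ∀ r, U r =ᵐ[@AddCircle.haarAddCircle (1 : ℝ) _] 0 := fun r => by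
    filter_upwards [hae, hnull] with t ht htY
    obtain ⟨ω, rfl⟩ := QuotientAddGroup.mk_surjective t
    have h1 := hinj ω (fun hω => htY ⟨ω, hω, rfl⟩) (fun r => U r (ω : AddCircle (1 : ℝ))) (by
      funext s
      rw [Matrix.mulVec, dotProduct, Pi.zero_apply, ← ht s]
      refine Finset.sum_congr rfl fun r _ => ?_
      rw [← (hGsum s r ω).tsum_eq])
    exact congrFun h1 r
  have hpj : (0 : ℤ) < p := by exact_mod_cast hp
  have hfin := hU ⟨(j % p).toNat, by have := Int.emod_lt_of_pos j hpj; omega⟩ (-(j / p))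
  rw [fourierCoeff_congr_ae (hUzero _)] at hfin
  have hj : (p : ℤ) * (-(-(j / p))) + ((j % p).toNat : ℕ) = j := by
    rw [Int.toNat_of_nonneg (Int.emod_nonneg j hpj.ne'), neg_neg, Int.mul_ediv_add_emod]
  simp only [hj] at hfin
  rw [← hfin]
  simp [fourierCoeff]

/-- An integrable function on `(0, 1]` with vanishing Fourier coefficients is zero. -/
theorem ae_restrict_eq_zero_of_integral_eq_zero {S : ℝ → ℂ}
    (hS : IntegrableOn S (Set.Ioc 0 1))
    (h : ∀ n : ℤ, ∫ y in Set.Ioc (0 : ℝ) 1, cexp (2 * π * I * n * y) * S y = 0) :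
    ∀ᵐ y ∂(volume.restrict (Set.Ioc (0 : ℝ) 1)), S y = 0 := by
  have hS1 : MemLp S 1 (volume.restrict (Set.Ioc (0 : ℝ) (0 + 1))) := by
    rw [zero_add]
    exact memLp_one_iff_integrable.2 hS
  have hInt : Integrable (AddCircle.liftIoc (1 : ℝ) 0 S) (@AddCircle.haarAddCircle (1 : ℝ) _) :=
    memLp_one_iff_integrable.1 hS1.memLp_liftIoc.haarAddCircle
  have hcoef : ∀ n, fourierCoeff (AddCircle.liftIoc (1 : ℝ) 0 S) n = 0 := fun n => by
    rw [fourierCoeff_liftIoc_eq, fourierCoeffOn_eq_integral,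
      intervalIntegral.integral_of_le (by norm_num), zero_add]
    have := h (-n)
    simp only [fourier_coe_apply, smul_eq_mul]
    norm_num at this ⊢
    exact this
  have h0 := ae_eq_zero_of_fourierCoeff_eq_zero hInt hcoef
  have h1 : AddCircle.liftIoc (1 : ℝ) 0 S =ᵐ[volume] 0 := by
    rw [AddCircle.volume_eq_smul_haarAddCircle, ENNReal.ofReal_one, one_smul]
    exact h0
  have h2 := (AddCircle.measurePreserving_mk (1 : ℝ) 0).quasiMeasurePreserving.ae h1
  rw [zero_add] at h2
  filter_upwards [h2, ae_restrict_mem measurableSet_Ioc] with y hy hy'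
  rw [← hy.trans (Pi.zero_apply _), AddCircle.liftIoc_coe_apply (by rwa [zero_add])]

/-- The translates of an integrable function on the line have summable `L¹` norms on `(0, 1]`. -/
theorem summable_integral_norm_comp_add_int {F : ℝ → ℂ} (hF : Integrable F) :
    Summable fun j : ℤ => ∫ y in Set.Ioc (0 : ℝ) 1, ‖F (y + j)‖ := by
  simpa only [intervalIntegral.integral_of_le (zero_le_one' ℝ)] using
    hF.norm.hasSum_intervalIntegral_comp_add_int.summable

/-- Integrating the periodization of a function over a period gives the integral over the line. -/
theorem integral_tsum_comp_add_int {F : ℝ → ℂ} (hF : Integrable F) :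
    ∫ y in Set.Ioc (0 : ℝ) 1, ∑' j : ℤ, F (y + j) = ∫ y, F y := by
  have h1 := hasSum_integral_of_summable_integral_norm
    (fun j : ℤ => (hF.comp_add_right (j : ℝ)).restrict) (summable_integral_norm_comp_add_int hF)
  have h2 := hF.hasSum_intervalIntegral_comp_add_int
  simp only [intervalIntegral.integral_of_le (zero_le_one' ℝ)] at h2
  exact h1.unique h2

/-- The periodization of an integrable function converges almost everywhere on `(0, 1]` to an
integrable function. -/
theorem exists_integrable_hasSum_comp_add_int {F : ℝ → ℂ} (hF : Integrable F) :
    ∃ S : ℝ → ℂ, IntegrableOn S (Set.Ioc 0 1) ∧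
      ∀ᵐ y ∂(volume.restrict (Set.Ioc (0 : ℝ) 1)), HasSum (fun j : ℤ => F (y + j)) (S y) := by
  have hInt : ∀ j : ℤ, Integrable (fun y => F (y + j)) (volume.restrict (Set.Ioc (0 : ℝ) 1)) :=
    fun j => (hF.comp_add_right (j : ℝ)).restrict
  set f : ℤ → Lp ℂ 1 (volume.restrict (Set.Ioc (0 : ℝ) 1)) := fun j => (hInt j).toL1 with hf
  have hnorm : ∑' j, ‖f j‖ₑ ≠ ⊤ := by
    have h1 : ∀ j, ‖f j‖ₑ = ENNReal.ofReal (∫ y in Set.Ioc (0 : ℝ) 1, ‖F (y + j)‖) := fun j => by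
      rw [← ofReal_norm, hf, L1.norm_of_fun_eq_integral_norm]
    simp_rw [h1]
    exact (summable_integral_norm_comp_add_int hF).tsum_ofReal_ne_top
  refine ⟨⇑(∑' j, f j), L1.integrable_coeFn _, ?_⟩
  filter_upwards [Lp.hasSum_coeFn_tsum hnorm, ae_all_iff.2 fun j => (hInt j).coeFn_toL1]
    with y hy hy'
  simpa only [hf, hy'] using hy

/-- If all Fourier integrals of an integrable function at integer frequencies vanish, so does its
periodization. -/
theorem hasSum_comp_add_int_zero {F : ℝ → ℂ} (hF : Integrable F)
    (h : ∀ n : ℤ, ∫ y : ℝ, cexp (2 * π * I * n * y) * F y = 0) :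
    ∀ᵐ y ∂(volume.restrict (Set.Ioc (0 : ℝ) 1)), HasSum (fun j : ℤ => F (y + j)) 0 := by
  obtain ⟨S, hS, hsum⟩ := exists_integrable_hasSum_comp_add_int hF
  have hnorm : ∀ (n : ℤ) (y : ℝ), ‖cexp (2 * π * I * n * y)‖ = 1 := fun n y => by
    rw [show 2 * π * I * n * y = ((2 * π * n * y : ℝ) : ℂ) * I by push_cast; ring,
      norm_exp_ofReal_mul_I]
  have hG : ∀ n : ℤ, Integrable fun y : ℝ => cexp (2 * π * I * n * y) * F y := fun n =>
    hF.bdd_mul (c := 1) (by fun_prop) (ae_of_all _ fun y => (hnorm n y).le)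
  have hzero := ae_restrict_eq_zero_of_integral_eq_zero hS fun n => by
    have hper : ∀ (y : ℝ) (j : ℤ), cexp (2 * π * I * n * (y + j : ℝ)) =
        cexp (2 * π * I * n * y) := fun y j => by
      rw [show (2 * π * I * n * (y + j : ℝ) : ℂ) = 2 * π * I * n * y + (n * j : ℤ) * (2 * π * I) by
        push_cast; ring, Complex.exp_add, exp_int_mul_two_pi_mul_I, mul_one]
    refine Eq.trans (integral_congr_ae ?_) ((integral_tsum_comp_add_int (hG n)).trans (h n))
    filter_upwards [hsum] with y hy
    simp only [hper]
    exact (hy.mul_left _).tsum_eq.symm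
  filter_upwards [hsum, hzero] with y hy hy'
  rwa [hy'] at hy

theorem ae_of_ae_restrict_forall_add_int {P : ℝ → Prop}
    (h : ∀ᵐ y ∂(volume.restrict (Set.Ioc (0 : ℝ) 1)), ∀ j : ℤ, P (y + j)) : ∀ᵐ y : ℝ, P y := by
  rw [ae_restrict_iff' measurableSet_Ioc] at h
  have h1 : ∀ n : ℤ, ∀ᵐ y : ℝ, y + n ∈ Set.Ioc (0 : ℝ) 1 → ∀ j : ℤ, P (y + n + j) := fun n =>
    (measurePreserving_add_right volume (n : ℝ)).quasiMeasurePreserving.ae h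
  filter_upwards [ae_all_iff.2 h1] with y hy
  obtain ⟨n, hn, -⟩ := existsUnique_add_zsmul_mem_Ioc (zero_lt_one' ℝ) y 0
  have := hy n (by simpa using hn) (-n)
  simpa using this

theorem memLp_expSum_mul_gaussian (Λ : Finset ℂ) (a : ℂ → ℂ) :
    MemLp (fun x : ℝ => (∑ lam ∈ Λ, a lam * cexp (lam * x)) * cexp (-π * x ^ 2)) 2 := by
  simp_rw [Finset.sum_mul]
  refine memLp_finsetSum _ fun lam _ => ?_
  simp_rw [mul_assoc]
  refine MemLp.const_mul ?_ (a lam)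
  rw [memLp_two_iff_integrable_sq_norm (by fun_prop)]
  have h := (integrable_cexp_quadratic' (b := -(2 * π)) (by simp [Real.pi_pos])
    (2 * lam) 0).norm
  refine h.congr (ae_of_all _ fun x => ?_)
  beta_reduce
  rw [← Complex.exp_add, norm_exp, norm_exp, ← Real.exp_nat_mul]
  congr 1
  have e : (x : ℂ) ^ 2 = ((x ^ 2 : ℝ) : ℂ) := by push_cast; rfl
  rw [e]
  simp
  ring

theorem ae_eq_zero_of_integral_shift_eq_zero {p q : ℕ} (hp : 0 < p) (hpq : p < q ∨ p = 1 ∧ q = 1)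
    {b : ℝ} (hb : 0 < b) {Λ : Finset ℂ} (hΛ : Λ.Nonempty) {a : ℂ → ℂ} (ha : ∀ lam ∈ Λ, a lam ≠ 0)
    {g : ℝ → ℂ} (hg : ∀ x : ℝ, g x = (∑ lam ∈ Λ, a lam * cexp (lam * x)) * cexp (-π * x ^ 2))
    {f : ℝ → ℂ} (hf : MemLp f 2)
    (h : ∀ k l : ℤ, ∫ x : ℝ, cexp (2 * π * I * l * (x / b : ℝ)) *
      (f x * g (x - p * b / q * k)) = 0) :
    f =ᵐ[volume] 0 := by
  have hq : 0 < q := by omega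
  have hgL : MemLp g 2 := by
    rw [show g = _ from funext hg]
    exact memLp_expSum_mul_gaussian Λ a
  have hF : ∀ k : ℤ, Integrable fun y : ℝ => f (b * y) * g (b * y - p * b / q * k) := fun k =>
    (hf.integrable_mul (hgL.comp_measurePreserving
      (measurePreserving_sub_right volume (p * b / q * k : ℝ)))).comp_mul_left' hb.ne'
  have hzint : ∀ k n : ℤ, ∫ y : ℝ, cexp (2 * π * I * n * y) *
      (f (b * y) * g (b * y - p * b / q * k)) = 0 := fun k n => by
    have h1 := Measure.integral_comp_mul_left (fun x : ℝ => cexp (2 * π * I * n * (x / b : ℝ)) *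
      (f x * g (x - p * b / q * k))) b
    rw [h, smul_zero] at h1
    simpa only [mul_div_cancel_left₀ _ hb.ne'] using h1
  have hsum := fun k => hasSum_comp_add_int_zero (hF k) (hzint k)
  have hsq : ∀ᵐ y ∂(volume.restrict (Set.Ioc (0 : ℝ) 1)),
      Summable fun j : ℤ => ‖f (b * (y + j))‖ ^ 2 := by
    have h1 : Integrable fun y : ℝ => ((‖f (b * y)‖ ^ 2 : ℝ) : ℂ) :=
      (((memLp_two_iff_integrable_sq_norm hf.1).1 hf).comp_mul_left' hb.ne').ofReal
    obtain ⟨S, -, hS⟩ := exists_integrable_hasSum_comp_add_int h1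
    filter_upwards [hS] with y hy
    exact Complex.summable_ofReal.1 hy.summable
  obtain ⟨Z, hZ, hZinj⟩ := exists_countable_zzMatrix hp hpq hb hΛ ha
  have hnull : ∀ᵐ y ∂(volume.restrict (Set.Ioc (0 : ℝ) 1)), b * y ∉ Z :=
    ae_restrict_of_ae (measure_eq_zero_iff_ae_notMem.mp
      ((hZ.preimage (mul_right_injective₀ hb.ne')).measure_zero volume))
  have hzero : ∀ᵐ y : ℝ, f (b * y) = 0 := by
    refine ae_of_ae_restrict_forall_add_int ?_
    filter_upwards [ae_all_iff.2 hsum, hsq, hnull] with y hy hy2 hyZ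
    obtain ⟨Y, hY, hinj⟩ := hZinj _ hyZ
    refine eq_zero_of_hasSum_shift hp hq hb hY hinj hy2 hg fun k => ?_
    convert hy k using 4 with j
    ring
  filter_upwards [(Measure.quasiMeasurePreserving_smul (volume : Measure ℝ)
    (inv_ne_zero hb.ne')).ae hzero] with x hx
  simpa [mul_inv_cancel_left₀ hb.ne'] using hx

theorem exists_nat_eq_div_of_le_one {x : ℝ} (hx : 0 < x) (hx1 : x ≤ 1)
    (hrat : ∃ r : ℚ, x = (r : ℝ)) :
    ∃ p q : ℕ, 0 < p ∧ (p < q ∨ p = 1 ∧ q = 1) ∧ x = p / q := by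
  obtain ⟨r, rfl⟩ := hrat
  have hr : 0 < r := by exact_mod_cast hx
  have hr1 : r ≤ 1 := by exact_mod_cast hx1
  rcases hr1.eq_or_lt with rfl | hlt
  · exact ⟨1, 1, one_pos, Or.inr ⟨rfl, rfl⟩, by simp⟩
  · have hn : 0 < r.num := Rat.num_pos.2 hr
    have hcast : ((r.num.toNat : ℕ) : ℤ) = r.num := Int.toNat_of_nonneg hn.le
    have hlt' : r.num < r.den := Rat.num_lt_denom_iff.2 hlt
    refine ⟨r.num.toNat, r.den, by omega, Or.inl (by omega), ?_⟩
    rw [Rat.cast_def]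
    congr 1
    exact_mod_cast hcast.symm

theorem memLp_modulation_shift {g : ℝ → ℂ} (hg : MemLp g 2) (α β : ℝ) (k l : ℤ) :
    MemLp (fun x : ℝ => cexp (2 * Real.pi * Complex.I * (β * l * x)) * g (x - α * k)) 2 := by
  have h1 : MemLp (fun x : ℝ => g (x - α * k)) 2 :=
    hg.comp_measurePreserving (measurePreserving_sub_right volume (α * k : ℝ))
  refine h1.of_le (f := fun x : ℝ => cexp (2 * Real.pi * Complex.I * (β * l * x)) * g (x - α * k))
    (AEStronglyMeasurable.mul (by fun_prop) h1.1) (ae_of_all _ fun x => ?_)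
  rw [norm_mul, show 2 * Real.pi * Complex.I * (β * l * x) =
    ((2 * Real.pi * (β * l * x) : ℝ) : ℂ) * I by push_cast; ring, norm_exp_ofReal_mul_I, one_mul]

theorem stmt_3 (Λ : Finset ℂ) (hΛ : Λ.Nonempty) (a : ℂ → ℂ) (ha : ∀ lam ∈ Λ, a lam ≠ 0)
    (g : ℝ → ℂ)
    (hg : ∀ x : ℝ, g x =
      (∑ lam ∈ Λ, a lam * Complex.exp (lam * x)) * Complex.exp (-(Real.pi) * x ^ 2))
    (α β : ℝ) (hα : 0 < α) (hβ : 0 < β)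
    (hrat : ∃ r : ℚ, α * β = (r : ℝ)) (hle : α * β ≤ 1) :
    GaborComplete g α β := by
  obtain ⟨p, q, hp, hpq, hαβ⟩ := exists_nat_eq_div_of_le_one (mul_pos hα hβ) hle hrat
  have hgL : MemLp g 2 := by
    rw [show g = _ from funext hg]
    exact memLp_expSum_mul_gaussian Λ a
  rw [GaborComplete, Submodule.topologicalClosure_eq_top_iff, Submodule.eq_bot_iff]
  intro f hf
  have hα' : α = p * β⁻¹ / q := by
    rw [mul_div_right_comm, ← hαβ, mul_inv_cancel_right₀ hβ.ne']
  have hconj : MemLp (fun x => (starRingEnd ℂ) (f x)) 2 := (Lp.memLp f).star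
  have hzero := ae_eq_zero_of_integral_shift_eq_zero hp hpq (inv_pos.2 hβ) hΛ ha hg hconj
    fun k l => by
      have hL := memLp_modulation_shift hgL α β k l
      have h1 := Submodule.mem_orthogonal' _ f |>.1 hf (hL.toLp _)
        (Submodule.subset_span ⟨k, l, hL.coeFn_toLp⟩)
      rw [L2.inner_def] at h1
      rw [← h1]
      refine integral_congr_ae ?_
      filter_upwards [hL.coeFn_toLp] with x hx
      rw [hx, RCLike.inner_apply, ← hα', div_inv_eq_mul]
      push_cast
      rw [show 2 * (π : ℂ) * I * l * (x * β) = 2 * π * I * (β * l * x) by ring]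
      ring
  rw [Lp.eq_zero_iff_ae_eq_zero]
  filter_upwards [hzero] with x hx
  simpa using hx
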